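/- arXiv:2508.09352 — 7 statements merged into one kernel-verified Lean document; each statement's English description precedes it below -/
import Mathlib

section
/- Let α₂, θ ∈ ℝ with α₂ ≠ 0 and θ ≠ 0, and let χ : ℝ → ℝ be continuously differentiable and bounded, with χ' integrable, with χ² − 1 integrable, and with ∫_ℝ (χ(X)² − 1) dX < 0. Then there exists a smooth, compactly supported, not identically zero function ψ : ℝ → ℂ² such that ∫_ℝ ‖α₂·σ₂·ψ''(X) + θ·χ(X)·σ₃·ψ(X)‖² dX < θ² · ∫_ℝ ‖ψ(X)‖² dX. (This is the quadratic-form content of Theorem 6.4: under the sign condition ∫(χ²−1) < 0, the operator 𝔖(0)² − θ² has a negative direction, which forces at least two eigenvalues of 𝔖(0) in its spectral gap.) -/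
open MeasureTheory Matrix Filter
open scoped ComplexConjugate

noncomputable section

/-- Pauli matrix σ₀ (identity). -/
def σ₀ : Matrix (Fin 2) (Fin 2) ℂ := 1

/-- Pauli matrix σ₁. -/
def σ₁ : Matrix (Fin 2) (Fin 2) ℂ := !![0, 1; 1, 0]

/-- Pauli matrix σ₂. -/
def σ₂ : Matrix (Fin 2) (Fin 2) ℂ := !![0, -Complex.I; Complex.I, 0]

/-- Pauli matrix σ₃. -/
def σ₃ : Matrix (Fin 2) (Fin 2) ℂ := !![1, 0; 0, -1]

/-- Action of a 2×2 complex matrix on ℂ² (with the Euclidean norm/inner product). -/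
def act (A : Matrix (Fin 2) (Fin 2) ℂ) (v : EuclideanSpace ℂ (Fin 2)) :
    EuclideanSpace ℂ (Fin 2) := Matrix.toEuclideanLin A v

/-- A real function times the first basis vector: the `σ₂` and `σ₃` terms are orthogonal. -/
lemma norm_sq_act_smul_single (α a b c : ℝ) :
    ‖α • act σ₂ (a • EuclideanSpace.single (0 : Fin 2) (1 : ℂ)) +
      b • act σ₃ (c • EuclideanSpace.single (0 : Fin 2) (1 : ℂ))‖ ^ 2 =
      (α * a) ^ 2 + (b * c) ^ 2 := by
  rw [EuclideanSpace.norm_sq_eq]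
  simp [act, σ₂, σ₃, Matrix.toLpLin_apply, Fin.sum_univ_two, mul_pow]
  ring

/-- Rescaling a cutoff `f` equal to `1` at the origin and bounded by `1` recovers the integral of
an integrable function in the limit. -/
lemma tendsto_integral_mul_comp_mul_sq {V f : ℝ → ℝ} (hV : Integrable V) (hf : Continuous f)
    (hf0 : f 0 = 1) (hf1 : ∀ x, |f x| ≤ 1) :
    Tendsto (fun ε : ℝ => ∫ x, V x * f (ε * x) ^ 2) (nhdsWithin 0 (Set.Ioi 0))
      (nhds (∫ x, V x)) := by
  refine tendsto_integral_filter_of_dominated_convergence (fun x => ‖V x‖) ?_ ?_ hV.norm ?_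
  · exact .of_forall fun ε => hV.aestronglyMeasurable.mul
      (Continuous.aestronglyMeasurable (by fun_prop))
  · refine .of_forall fun ε => .of_forall fun x => ?_
    rw [norm_mul]
    refine mul_le_of_le_one_right (norm_nonneg _) ?_
    rw [Real.norm_eq_abs, abs_pow]
    exact pow_le_one₀ (abs_nonneg _) (hf1 _)
  · refine .of_forall fun x => tendsto_nhdsWithin_of_tendsto_nhds ?_
    have h : Continuous fun ε : ℝ => V x * f (ε * x) ^ 2 := by fun_prop
    simpa [hf0] using h.tendsto 0

/-- Under the sign condition `∫ (χ² − 1) < 0`, the quadratic form of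
`𝔖(0)² − θ²` has a negative direction among smooth compactly supported functions. -/
theorem negative_direction_of_sign_condition
    (α₂ θ : ℝ) (hα : α₂ ≠ 0) (hθ : θ ≠ 0)
    (χ : ℝ → ℝ) (hχ : ContDiff ℝ 1 χ) (hχbd : ∃ C, ∀ X, |χ X| ≤ C)
    (hχ' : Integrable (deriv χ))
    (hχint : Integrable (fun X => χ X ^ 2 - 1))
    (hsign : (∫ X : ℝ, (χ X ^ 2 - 1)) < 0) :
    ∃ ψ : ℝ → EuclideanSpace ℂ (Fin 2),
      ContDiff ℝ (⊤ : ℕ∞) ψ ∧ HasCompactSupport ψ ∧ ψ ≠ 0 ∧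
      (∫ X : ℝ, ‖α₂ • act σ₂ (deriv (deriv ψ) X) + (θ * χ X) • act σ₃ (ψ X)‖ ^ 2)
        < θ ^ 2 * ∫ X : ℝ, ‖ψ X‖ ^ 2 := by
  let f : ContDiffBump (0 : ℝ) := ⟨1, 2, one_pos, one_lt_two⟩
  let e : EuclideanSpace ℂ (Fin 2) := EuclideanSpace.single 0 1
  have hf : ContDiff ℝ (⊤ : ℕ∞) f := f.contDiff
  have hf0 : f 0 = 1 := f.eventuallyEq_one.self_of_nhds
  have hf1 : ∀ x, |f x| ≤ 1 := fun x => by rw [abs_of_nonneg f.nonneg]; exact f.le_one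
  have hf' : ContDiff ℝ (⊤ : ℕ∞) (deriv f) := (contDiff_infty_iff_deriv.1 hf).2
  have hf'' : ContDiff ℝ (⊤ : ℕ∞) (deriv (deriv f)) := (contDiff_infty_iff_deriv.1 hf').2
  have hfs : HasCompactSupport f := f.hasCompactSupport
  have hfs'' : HasCompactSupport (deriv (deriv f)) := hfs.deriv.deriv
  have hlim : Tendsto (fun ε : ℝ => α₂ ^ 2 * ε ^ 3 * (∫ x, deriv (deriv f) x ^ 2) +
      θ ^ 2 * ∫ x, (χ x ^ 2 - 1) * f (ε * x) ^ 2) (nhdsWithin 0 (Set.Ioi 0))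
      (nhds (θ ^ 2 * ∫ x, (χ x ^ 2 - 1))) := by
    have h₁ : Tendsto (fun ε : ℝ => α₂ ^ 2 * ε ^ 3 * (∫ x, deriv (deriv f) x ^ 2))
        (nhdsWithin 0 (Set.Ioi 0)) (nhds 0) := by
      refine tendsto_nhdsWithin_of_tendsto_nhds ?_
      have h : Continuous fun ε : ℝ => α₂ ^ 2 * ε ^ 3 * (∫ x, deriv (deriv f) x ^ 2) := by
        fun_prop
      simpa using h.tendsto 0
    simpa using h₁.add
      ((tendsto_integral_mul_comp_mul_sq hχint hf.continuous hf0 hf1).const_mul (θ ^ 2))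
  have hneg : θ ^ 2 * ∫ x, (χ x ^ 2 - 1) < 0 := mul_neg_of_pos_of_neg (by positivity) hsign
  obtain ⟨ε, hlt, hε⟩ :=
    ((hlim.eventually (gt_mem_nhds hneg)).and self_mem_nhdsWithin).exists
  replace hε : 0 < ε := hε
  have hcomp : ∀ {g : ℝ → ℝ}, HasCompactSupport g → HasCompactSupport fun x => g (ε * x) :=
    fun hg => hg.comp_homeomorph (Homeomorph.mulLeft₀ ε hε.ne')
  have hsq : ∀ {g : ℝ → ℝ}, HasCompactSupport g → HasCompactSupport fun x => g (ε * x) ^ 2 :=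
    fun hg => (hcomp hg).comp_left (g := fun y : ℝ => y ^ 2) (by simp)
  have hψ' : deriv (deriv fun x => f (ε * x) • e) =
      fun x => (ε ^ 2 * deriv (deriv f) (ε * x)) • e := by
    have hd : ∀ {g : ℝ → ℝ}, ContDiff ℝ (⊤ : ℕ∞) g → ∀ c x : ℝ,
        HasDerivAt (fun x => (c * g (ε * x)) • e) ((c * ε * deriv g (ε * x)) • e) x := by
      intro g hg c x
      have h₁ : HasDerivAt g (deriv g (ε * x)) (ε * x) :=
        ((hg.differentiable (by simp)) _).hasDerivAt
      have h₂ : HasDerivAt (fun x => ε * x) ε x := by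
        simpa using (hasDerivAt_id x).const_mul ε
      refine (((h₁.comp x h₂).const_mul c).smul_const e).congr_deriv ?_
      congr 1
      ring
    have h₁ : (deriv fun x => f (ε * x) • e) = fun x => (ε * deriv f (ε * x)) • e := by
      funext x
      simpa using (hd hf 1 x).deriv
    rw [h₁]
    funext x
    simpa [sq] using (hd hf' ε x).deriv
  refine ⟨fun x => f (ε * x) • e, ?_, ?_, ?_, ?_⟩
  · exact (hf.comp (contDiff_const.mul contDiff_id)).smul contDiff_const
  · exact (hcomp hfs).smul_right
  · intro h
    have := congrFun h 0
    simp [hf0, e] at this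
  · have hI₁ : Integrable fun x => f (ε * x) ^ 2 := by
      have hc := hf.continuous
      refine Continuous.integrable_of_hasCompactSupport (by fun_prop) ?_
      exact hsq hfs
    have hI₂ : Integrable fun x => deriv (deriv f) (ε * x) ^ 2 := by
      have hc := hf''.continuous
      refine Continuous.integrable_of_hasCompactSupport (by fun_prop) ?_
      exact hsq hfs''
    have hI₃ : Integrable fun x => (χ x ^ 2 - 1) * f (ε * x) ^ 2 := by
      have hc := hf.continuous
      have hc' := hχ.continuous
      refine Continuous.integrable_of_hasCompactSupport (by fun_prop) ?_
      exact (hsq hfs).mul_left (f := fun x => χ x ^ 2 - 1)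
    have hscale : ∫ x, deriv (deriv f) (ε * x) ^ 2 = ε⁻¹ * ∫ x, deriv (deriv f) x ^ 2 := by
      rw [Measure.integral_comp_mul_left (fun x => deriv (deriv f) x ^ 2) ε,
        abs_of_pos (inv_pos.2 hε), smul_eq_mul]
    have hnorm : ∀ x, ‖f (ε * x) • e‖ ^ 2 = f (ε * x) ^ 2 := fun x => by
      simp [e, norm_smul]
    have hexp : ∀ x, ‖α₂ • act σ₂ (deriv (deriv fun x => f (ε * x) • e) x) +
        (θ * χ x) • act σ₃ (f (ε * x) • e)‖ ^ 2 =
        α₂ ^ 2 * ε ^ 4 * deriv (deriv f) (ε * x) ^ 2 +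
          θ ^ 2 * ((χ x ^ 2 - 1) * f (ε * x) ^ 2) + θ ^ 2 * f (ε * x) ^ 2 := fun x => by
      rw [hψ', norm_sq_act_smul_single]
      ring
    simp only [hexp, hnorm]
    rw [integral_add (by exact (hI₂.const_mul _).add (hI₃.const_mul _)) (hI₁.const_mul _),
      integral_add (hI₂.const_mul _) (hI₃.const_mul _), integral_const_mul, integral_const_mul,
      integral_const_mul, hscale]
    have hpow : α₂ ^ 2 * ε ^ 4 * (ε⁻¹ * ∫ x, deriv (deriv f) x ^ 2) =
        α₂ ^ 2 * ε ^ 3 * ∫ x, deriv (deriv f) x ^ 2 := by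
      field_simp
    linarith
end
end

section
/- Let α₂, θ ∈ ℝ with α₂ ≠ 0 and θ ≠ 0, and let χ : ℝ → ℝ be continuously differentiable and bounded, with χ' integrable, with χ² − 1 integrable, and with χ(X) → 1 as X → +∞ and χ(X) → −1 as X → −∞ (a domain-wall function). Then there exists ε₀ > 0 such that for every ε with 0 < ε < ε₀ there exists a smooth, compactly supported, not identically zero function ψ : ℝ → ℂ² with ∫_ℝ ‖α₂·σ₂·ψ''(X) + θ·χ(X/ε)·σ₃·ψ(X)‖² dX < θ² · ∫_ℝ ‖ψ(X)‖² dX. (This is the quadratic-form content of Theorem 6.5, part 1: steep domain walls produce at least two eigenvalues in the spectral gap even when the sign condition ∫(χ²−1) < 0 fails.) -/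
open MeasureTheory Matrix Filter
open scoped ComplexConjugate

noncomputable section

/-- The spinor field with components `u` and `I * w`. -/
def spinor (u w : ℝ → ℝ) (X : ℝ) : EuclideanSpace ℂ (Fin 2) :=
  u X • EuclideanSpace.single 0 (1 : ℂ) + w X • EuclideanSpace.single 1 Complex.I

lemma norm_sq_spinor (u w : ℝ → ℝ) (X : ℝ) : ‖spinor u w X‖ ^ 2 = u X ^ 2 + w X ^ 2 := by
  simp [spinor, EuclideanSpace.norm_sq_eq, Fin.sum_univ_two]

lemma norm_sq_act_spinor (a t : ℝ) (p q u w : ℝ → ℝ) (X : ℝ) :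
    ‖a • act σ₂ (spinor p q X) + t • act σ₃ (spinor u w X)‖ ^ 2
      = (a * q X + t * u X) ^ 2 + (a * p X - t * w X) ^ 2 := by
  have h0 : (a • act σ₂ (spinor p q X) + t • act σ₃ (spinor u w X)) 0
      = ((a * q X + t * u X : ℝ) : ℂ) := by
    simp [act, σ₂, σ₃, spinor, Matrix.toEuclideanLin, Matrix.toLpLin_apply, dotProduct,
      Fin.sum_univ_two]
    linear_combination (-a * q X : ℂ) * Complex.I_mul_I
  have h1 : (a • act σ₂ (spinor p q X) + t • act σ₃ (spinor u w X)) 1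
      = ((a * p X - t * w X : ℝ) : ℂ) * Complex.I := by
    simp [act, σ₂, σ₃, spinor, Matrix.toEuclideanLin, Matrix.toLpLin_apply, dotProduct,
      Fin.sum_univ_two]
    ring
  rw [EuclideanSpace.norm_sq_eq, Fin.sum_univ_two, h0, h1, norm_mul, Complex.norm_I, mul_one,
    Complex.norm_real, Complex.norm_real, Real.norm_eq_abs, Real.norm_eq_abs, sq_abs, sq_abs]

lemma deriv_spinor {u w : ℝ → ℝ} (hu : Differentiable ℝ u) (hw : Differentiable ℝ w) :
    deriv (spinor u w) = spinor (deriv u) (deriv w) := by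
  funext X
  exact (((hu X).hasDerivAt.smul_const _).add ((hw X).hasDerivAt.smul_const _)).deriv

lemma contDiff_spinor {n : WithTop ℕ∞} {u w : ℝ → ℝ} (hu : ContDiff ℝ n u) (hw : ContDiff ℝ n w) :
    ContDiff ℝ n (spinor u w) :=
  (hu.smul contDiff_const).add (hw.smul contDiff_const)

lemma hasCompactSupport_spinor {u w : ℝ → ℝ} (hu : HasCompactSupport u)
    (hw : HasCompactSupport w) : HasCompactSupport (spinor u w) :=
  HasCompactSupport.add (f := fun X => u X • EuclideanSpace.single (0 : Fin 2) (1 : ℂ))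
    (f' := fun X => w X • EuclideanSpace.single (1 : Fin 2) Complex.I)
    hu.smul_right hw.smul_right

lemma integrable_sq {f : ℝ → ℝ} (hf : Continuous f) (hfc : HasCompactSupport f) :
    Integrable (fun X => f X ^ 2) := by
  simp only [sq]
  exact (hf.mul hf).integrable_of_hasCompactSupport (hfc.mul_right (f' := f))

/-- The integral of the derivative of a compactly supported function against the sign function. -/
lemma integral_sign_mul_deriv {W : ℝ → ℝ} (hW : ContDiff ℝ 1 W) (hc : HasCompactSupport W) :
    Integrable (fun X => (if 0 < X then 1 else -1) * deriv W X) ∧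
      ∫ X, (if 0 < X then 1 else -1) * deriv W X = -2 * W 0 := by
  have hint : Integrable (deriv W) :=
    (hW.continuous_deriv le_rfl).integrable_of_hasCompactSupport hc.deriv
  have heq : (fun X => (if 0 < X then 1 else -1) * deriv W X)
      = fun X => (Set.Ioi (0 : ℝ)).indicator (fun Y => 2 * deriv W Y) X - deriv W X := by
    funext X
    by_cases h : 0 < X
    · simp [h]; ring
    · simp [h]
  have hind := (hint.const_mul 2).indicator (measurableSet_Ioi (a := (0 : ℝ)))
  have hzero : ∫ X, deriv W X = 0 :=
    integral_eq_zero_of_hasDerivAt_of_integrable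
      (fun X => (hW.differentiable one_ne_zero X).hasDerivAt) hint
      (hW.continuous.integrable_of_hasCompactSupport hc)
  rw [heq]
  refine ⟨hind.sub hint, ?_⟩
  rw [integral_sub hind hint, integral_indicator measurableSet_Ioi, integral_const_mul,
    hc.integral_Ioi_deriv_eq hW, hzero]
  ring

/-- As the domain wall becomes infinitely steep, the quadratic form converges to the one with
the sign function in place of the profile. -/
lemma tendsto_integral_steep {χ : ℝ → ℝ} (hχ : Continuous χ) (hχbd : ∃ C, ∀ X, |χ X| ≤ C)
    (hplus : Tendsto χ atTop (nhds 1)) (hminus : Tendsto χ atBot (nhds (-1)))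
    (a θ : ℝ) {p q u w : ℝ → ℝ} (hp : Continuous p) (hq : Continuous q) (hu : Continuous u)
    (hw : Continuous w) (hpc : HasCompactSupport p) (hqc : HasCompactSupport q)
    (huc : HasCompactSupport u) (hwc : HasCompactSupport w) :
    Tendsto (fun ε : ℝ => ∫ X, ((a * q X + θ * χ (X / ε) * u X) ^ 2
        + (a * p X - θ * χ (X / ε) * w X) ^ 2)) (nhdsWithin 0 (Set.Ioi 0))
      (nhds (∫ X, ((a * q X + θ * (if 0 < X then 1 else -1) * u X) ^ 2
        + (a * p X - θ * (if 0 < X then 1 else -1) * w X) ^ 2))) := by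
  obtain ⟨C, hC⟩ := hχbd
  refine tendsto_integral_filter_of_dominated_convergence
    (fun X => 2 * a ^ 2 * (p X ^ 2 + q X ^ 2) + 2 * θ ^ 2 * C ^ 2 * (u X ^ 2 + w X ^ 2)) ?_ ?_ ?_ ?_
  · refine Eventually.of_forall fun ε => Continuous.aestronglyMeasurable ?_
    fun_prop
  · refine Eventually.of_forall fun ε => Eventually.of_forall fun X => ?_
    have hsq : χ (X / ε) ^ 2 ≤ C ^ 2 := sq_le_sq' (abs_le.1 (hC _)).1 (abs_le.1 (hC _)).2
    rw [Real.norm_of_nonneg (by positivity)]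
    have h := mul_le_mul_of_nonneg_left hsq
      (by positivity : 0 ≤ 2 * θ ^ 2 * (u X ^ 2 + w X ^ 2))
    nlinarith [sq_nonneg (a * q X - θ * χ (X / ε) * u X),
      sq_nonneg (a * p X + θ * χ (X / ε) * w X)]
  · exact (((integrable_sq hp hpc).add (integrable_sq hq hqc)).const_mul _).add
      (((integrable_sq hu huc).add (integrable_sq hw hwc)).const_mul _)
  · filter_upwards [compl_mem_ae_iff.2 (measure_singleton (0 : ℝ))] with X hX
    have hX0 : X ≠ 0 := hX
    have hlim : Tendsto (fun ε : ℝ => χ (X / ε)) (nhdsWithin 0 (Set.Ioi 0))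
        (nhds (if 0 < X then 1 else -1)) := by
      simp only [div_eq_mul_inv]
      rcases lt_or_gt_of_ne hX0 with h | h
      · rw [if_neg h.not_gt]
        exact hminus.comp (tendsto_inv_nhdsGT_zero.const_mul_atTop_of_neg h)
      · rw [if_pos h]
        exact hplus.comp (tendsto_inv_nhdsGT_zero.const_mul_atTop h)
    exact ((((hlim.const_mul θ).mul_const _).const_add _).pow 2).add
      ((((hlim.const_mul θ).mul_const _).const_sub _).pow 2)

/-- The quadratic form for the sign profile, evaluated on smooth spinors. -/
lemma integral_sign_form (a θ : ℝ) {u w : ℝ → ℝ} (hu : ContDiff ℝ (⊤ : ℕ∞) u)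
    (hw : ContDiff ℝ (⊤ : ℕ∞) w) (huc : HasCompactSupport u) (hwc : HasCompactSupport w) :
    ∫ X, ((a * deriv (deriv w) X + θ * (if 0 < X then 1 else -1) * u X) ^ 2
        + (a * deriv (deriv u) X - θ * (if 0 < X then 1 else -1) * w X) ^ 2)
      = a ^ 2 * (∫ X, deriv (deriv u) X ^ 2) + a ^ 2 * (∫ X, deriv (deriv w) X ^ 2)
        + θ ^ 2 * (∫ X, (u X ^ 2 + w X ^ 2))
        - 4 * a * θ * (u 0 * deriv w 0 - w 0 * deriv u 0) := by
  have hu' : ContDiff ℝ (⊤ : ℕ∞) (deriv u) := by simpa using hu.iterate_deriv 1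
  have hw' : ContDiff ℝ (⊤ : ℕ∞) (deriv w) := by simpa using hw.iterate_deriv 1
  have hu'' : ContDiff ℝ (⊤ : ℕ∞) (deriv (deriv u)) := by simpa using hu'.iterate_deriv 1
  have hw'' : ContDiff ℝ (⊤ : ℕ∞) (deriv (deriv w)) := by simpa using hw'.iterate_deriv 1
  set W : ℝ → ℝ := fun X => u X * deriv w X - w X * deriv u X with hWdef
  have hW : ContDiff ℝ 1 W :=
    ((hu.mul hw').sub (hw.mul hu')).of_le (by exact_mod_cast le_top)
  have hWc : HasCompactSupport W := (huc.mul_right).sub (hwc.mul_right)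
  have hWd (X : ℝ) : deriv W X = u X * deriv (deriv w) X - w X * deriv (deriv u) X := by
    have d {f : ℝ → ℝ} (hf : ContDiff ℝ (⊤ : ℕ∞) f) : HasDerivAt f (deriv f X) X :=
      (hf.differentiable (by simp) X).hasDerivAt
    refine (((d hu).mul (d hw')).sub ((d hw).mul (d hu'))).deriv.trans ?_
    ring
  obtain ⟨hWi, hWv⟩ := integral_sign_mul_deriv hW hWc
  have i1 := (integrable_sq hu''.continuous huc.deriv.deriv).const_mul (a ^ 2)
  have i2 := (integrable_sq hw''.continuous hwc.deriv.deriv).const_mul (a ^ 2)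
  have i3 : Integrable fun X => θ ^ 2 * (u X ^ 2 + w X ^ 2) :=
    ((integrable_sq hu.continuous huc).add (integrable_sq hw.continuous hwc)).const_mul (θ ^ 2)
  have i4 := hWi.const_mul (2 * a * θ)
  calc _ = ∫ X, (a ^ 2 * deriv (deriv u) X ^ 2 + a ^ 2 * deriv (deriv w) X ^ 2
        + θ ^ 2 * (u X ^ 2 + w X ^ 2)
        + 2 * a * θ * ((if 0 < X then 1 else -1) * deriv W X)) := by
        congr 1
        funext X
        rw [hWd]
        split_ifs <;> ring
    _ = _ := by
        rw [integral_add (by exact (i1.add i2).add i3) i4, integral_add (by exact i1.add i2) i3,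
          integral_add i1 i2,
          integral_const_mul, integral_const_mul, integral_const_mul, integral_const_mul, hWv]
        simp only [hWdef]
        ring

/-- A steep domain wall has a negative direction as soon as the Wronskian of a pair of test
functions at the wall dominates their bending energy. -/
lemma negative_direction_of_wronskian {a θ : ℝ} {χ : ℝ → ℝ} (hχ : Continuous χ)
    (hχbd : ∃ C, ∀ X, |χ X| ≤ C)
    (hplus : Tendsto χ atTop (nhds 1)) (hminus : Tendsto χ atBot (nhds (-1)))
    {u w : ℝ → ℝ} (hu : ContDiff ℝ (⊤ : ℕ∞) u)
    (hw : ContDiff ℝ (⊤ : ℕ∞) w) (huc : HasCompactSupport u) (hwc : HasCompactSupport w)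
    (hneg : a ^ 2 * (∫ X, deriv (deriv u) X ^ 2) + a ^ 2 * (∫ X, deriv (deriv w) X ^ 2)
      < 4 * a * θ * (u 0 * deriv w 0 - w 0 * deriv u 0)) :
    ∃ ε₀ > 0, ∀ ε : ℝ, 0 < ε → ε < ε₀ →
      ∃ ψ : ℝ → EuclideanSpace ℂ (Fin 2),
        ContDiff ℝ (⊤ : ℕ∞) ψ ∧ HasCompactSupport ψ ∧ ψ ≠ 0 ∧
        (∫ X : ℝ, ‖a • act σ₂ (deriv (deriv ψ) X) + (θ * χ (X / ε)) • act σ₃ (ψ X)‖ ^ 2)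
          < θ ^ 2 * ∫ X : ℝ, ‖ψ X‖ ^ 2 := by
  have hu' : ContDiff ℝ (⊤ : ℕ∞) (deriv u) := by simpa using hu.iterate_deriv 1
  have hw' : ContDiff ℝ (⊤ : ℕ∞) (deriv w) := by simpa using hw.iterate_deriv 1
  have hu'' : ContDiff ℝ (⊤ : ℕ∞) (deriv (deriv u)) := by simpa using hu'.iterate_deriv 1
  have hw'' : ContDiff ℝ (⊤ : ℕ∞) (deriv (deriv w)) := by simpa using hw'.iterate_deriv 1
  have hdd : deriv (deriv (spinor u w)) = spinor (deriv (deriv u)) (deriv (deriv w)) := by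
    rw [deriv_spinor (hu.differentiable (by simp)) (hw.differentiable (by simp)),
      deriv_spinor (hu'.differentiable (by simp)) (hw'.differentiable (by simp))]
  have hlim := tendsto_integral_steep hχ hχbd hplus hminus a θ hu''.continuous hw''.continuous
    hu.continuous hw.continuous huc.deriv.deriv hwc.deriv.deriv huc hwc
  rw [integral_sign_form a θ hu hw huc hwc] at hlim
  have hev := hlim.eventually_lt_const
    (show _ < θ ^ 2 * ∫ X, (u X ^ 2 + w X ^ 2) by linarith)
  obtain ⟨ε₀, hε₀, hsub⟩ := mem_nhdsGT_iff_exists_Ioo_subset.1 hev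
  refine ⟨ε₀, hε₀, fun ε h0 h1 => ?_⟩
  have hlt : (∫ X : ℝ, ‖a • act σ₂ (deriv (deriv (spinor u w)) X)
      + (θ * χ (X / ε)) • act σ₃ (spinor u w X)‖ ^ 2)
      < θ ^ 2 * ∫ X : ℝ, ‖spinor u w X‖ ^ 2 := by
    simp only [hdd, norm_sq_act_spinor, norm_sq_spinor]
    exact hsub ⟨h0, h1⟩
  refine ⟨spinor u w, contDiff_spinor hu hw, hasCompactSupport_spinor huc hwc, ?_, hlt⟩
  intro hzero
  have hnonneg : 0 ≤ ∫ X : ℝ, ‖a • act σ₂ (deriv (deriv (spinor u w)) X)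
      + (θ * χ (X / ε)) • act σ₃ (spinor u w X)‖ ^ 2 := integral_nonneg fun X => by positivity
  refine absurd (hnonneg.trans_lt hlt) ?_
  simp [hzero]

lemma deriv_deriv_comp_mul_left (l : ℝ) (f : ℝ → ℝ) (X : ℝ) :
    deriv (deriv fun Y => f (l * Y)) X = l ^ 2 * deriv (deriv f) (l * X) := by
  have h (g : ℝ → ℝ) : deriv (fun Y => g (l * Y)) = fun Y => l * deriv g (l * Y) := by
    funext Y
    rw [deriv_comp_mul_left, smul_eq_mul]
  rw [h, deriv_const_mul_field, h]
  ring

lemma integral_sq_deriv_deriv_comp_mul_left {l : ℝ} (hl : 0 < l) (f : ℝ → ℝ) :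
    ∫ X, deriv (deriv fun Y => f (l * Y)) X ^ 2 = l ^ 3 * ∫ X, deriv (deriv f) X ^ 2 := by
  simp only [deriv_deriv_comp_mul_left, mul_pow]
  rw [integral_const_mul, Measure.integral_comp_mul_left (fun Y => deriv (deriv f) Y ^ 2),
    abs_of_pos (inv_pos.2 hl), smul_eq_mul]
  field_simp

/-- For a domain-wall profile χ, sufficiently steep rescalings χ(·/ε)
produce a negative direction for the quadratic form of `𝔖(0)² − θ²`. -/
theorem negative_direction_for_steep_domain_walls
    (α₂ θ : ℝ) (hα : α₂ ≠ 0) (hθ : θ ≠ 0)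
    (χ : ℝ → ℝ) (hχ : ContDiff ℝ 1 χ) (hχbd : ∃ C, ∀ X, |χ X| ≤ C)
    (hχ' : Integrable (deriv χ))
    (hχint : Integrable (fun X => χ X ^ 2 - 1))
    (hplus : Tendsto χ atTop (nhds 1)) (hminus : Tendsto χ atBot (nhds (-1))) :
    ∃ ε₀ > 0, ∀ ε : ℝ, 0 < ε → ε < ε₀ →
      ∃ ψ : ℝ → EuclideanSpace ℂ (Fin 2),
        ContDiff ℝ (⊤ : ℕ∞) ψ ∧ HasCompactSupport ψ ∧ ψ ≠ 0 ∧
        (∫ X : ℝ, ‖α₂ • act σ₂ (deriv (deriv ψ) X) + (θ * χ (X / ε)) • act σ₃ (ψ X)‖ ^ 2)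
          < θ ^ 2 * ∫ X : ℝ, ‖ψ X‖ ^ 2 := by
  let f : ContDiffBump (0 : ℝ) := ⟨1, 2, one_pos, one_lt_two⟩
  have hf0 : f 0 = 1 := f.one_of_mem_closedBall (by simp [f])
  have hf : ContDiff ℝ (⊤ : ℕ∞) f := f.contDiff
  set g : ℝ → ℝ := fun X => α₂ * θ * X * f X with hgdef
  have hg : ContDiff ℝ (⊤ : ℕ∞) g := (contDiff_const.mul contDiff_id).mul hf
  have hgc : HasCompactSupport g := f.hasCompactSupport.mul_left
  have hg0 : g 0 = 0 := by simp [hgdef]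
  have hg'0 : deriv g 0 = α₂ * θ := by
    have h := (((hasDerivAt_id (0 : ℝ)).const_mul (α₂ * θ)).mul
      (hf.differentiable (by simp) 0).hasDerivAt).deriv
    refine h.trans ?_
    simp [hf0]
  set A := ∫ X, deriv (deriv f) X ^ 2
  set B := ∫ X, deriv (deriv g) X ^ 2
  obtain ⟨l, hl, hsmall⟩ : ∃ l : ℝ, 0 < l ∧ l ^ 2 * (A + B) < 4 * θ ^ 2 := by
    have hcont : Tendsto (fun l : ℝ => l ^ 2 * (A + B)) (nhdsWithin 0 (Set.Ioi 0)) (nhds 0) := by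
      have h : Continuous fun l : ℝ => l ^ 2 * (A + B) := by fun_prop
      simpa using (h.tendsto 0).mono_left nhdsWithin_le_nhds
    have hev := hcont.eventually_lt_const (show (0 : ℝ) < 4 * θ ^ 2 by positivity)
    obtain ⟨l, h1, h2⟩ := (hev.and self_mem_nhdsWithin).exists
    exact ⟨l, h2, h1⟩
  have hmul : ContDiff ℝ (⊤ : ℕ∞) fun X : ℝ => l * X := contDiff_const.mul contDiff_id
  have hcs {k : ℝ → ℝ} (hk : HasCompactSupport k) : HasCompactSupport fun X => k (l * X) :=
    hk.comp_homeomorph (Homeomorph.mulLeft₀ l hl.ne')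
  refine negative_direction_of_wronskian (u := fun X => f (l * X)) (w := fun X => g (l * X))
    hχ.continuous hχbd hplus hminus (hf.comp hmul) (hg.comp hmul) (hcs f.hasCompactSupport)
    (hcs hgc) ?_
  rw [integral_sq_deriv_deriv_comp_mul_left hl f, integral_sq_deriv_deriv_comp_mul_left hl g,
    deriv_comp_mul_left, mul_zero, hf0, hg0, hg'0, smul_eq_mul]
  have h := mul_lt_mul_of_pos_left hsmall (show 0 < α₂ ^ 2 * l by positivity)
  linear_combination h
end
end

section
/- Let a₀, a₁, a₂, b₀, b₁, b₂, c ∈ ℝ and assume d := −a₀² + a₁² + a₂² > 0. Then for all ξ, ξ', κ ∈ ℝ, Ω₊(ξ, κ) − Ω₋(ξ', κ) ≥ 2·|c|·Real.sqrt (d / (a₁² + a₂²)). (This is the uniform band-gap estimate of Proposition 6.8 for the family of Dirac operators κ ↦ 𝔇⁺(κ): at each parallel quasimomentum κ, the upper and lower symbol bands are separated by a gap of width at least 2|c|√(d/(a₁²+a₂²)).) -/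
noncomputable section

/-- A lower bound for `√(p² + q² + c²)` by a linear function of the component of `(p, q)` along
`(a₁, a₂)`, with slope less than one. -/
lemma linear_add_le_sqrt (a₀ a₁ a₂ c p q : ℝ) (hd : 0 < -a₀ ^ 2 + a₁ ^ 2 + a₂ ^ 2) :
    a₀ * (a₁ * p + a₂ * q) / (a₁ ^ 2 + a₂ ^ 2) +
        |c| * Real.sqrt ((-a₀ ^ 2 + a₁ ^ 2 + a₂ ^ 2) / (a₁ ^ 2 + a₂ ^ 2)) ≤
      Real.sqrt (p ^ 2 + q ^ 2 + c ^ 2) := by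
  have hA : 0 < a₁ ^ 2 + a₂ ^ 2 := by nlinarith [sq_nonneg a₀]
  set r := Real.sqrt (a₁ ^ 2 + a₂ ^ 2)
  set s := Real.sqrt ((-a₀ ^ 2 + a₁ ^ 2 + a₂ ^ 2) / (a₁ ^ 2 + a₂ ^ 2)) with hs
  have hr0 : 0 < r := Real.sqrt_pos.2 hA
  have hr2 : r ^ 2 = a₁ ^ 2 + a₂ ^ 2 := Real.sq_sqrt hA.le
  obtain ⟨β, hβ⟩ : ∃ β, β = a₀ / r := ⟨_, rfl⟩
  obtain ⟨u, hu⟩ : ∃ u, u = (a₁ * p + a₂ * q) / r := ⟨_, rfl⟩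
  have hsum : s ^ 2 = 1 - β ^ 2 := by
    rw [hs, Real.sq_sqrt (by positivity), hβ, div_pow, hr2]
    field_simp
    ring
  have hprod : a₀ * (a₁ * p + a₂ * q) / (a₁ ^ 2 + a₂ ^ 2) = β * u := by
    rw [← hr2, hβ, hu]
    field_simp
  have hu2 : u ^ 2 ≤ p ^ 2 + q ^ 2 := by
    rw [hu, div_pow, hr2, div_le_iff₀ hA]
    nlinarith [sq_nonneg (a₁ * q - a₂ * p)]
  rw [hprod]
  apply Real.le_sqrt_of_sq_le
  have key : (β * u + |c| * s) ^ 2 + (s * u - β * |c|) ^ 2 = u ^ 2 + c ^ 2 := by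
    linear_combination (u ^ 2 + |c| ^ 2) * hsum + sq_abs c
  nlinarith [sq_nonneg (s * u - β * |c|)]

/-- uniform band-gap estimate of Proposition 6.8: at each κ, the upper
and lower symbol bands of the Dirac operator 𝔇⁺(κ) are separated by a gap of width at
least `2|c|√(d/(a₁² + a₂²))` where `d = −a₀² + a₁² + a₂²`. -/
theorem dirac_symbol_uniform_band_gap
    (a₀ a₁ a₂ b₀ b₁ b₂ c : ℝ) (hd : 0 < -a₀ ^ 2 + a₁ ^ 2 + a₂ ^ 2) :
    ∀ ξ ξ' κ : ℝ,
      2 * |c| * Real.sqrt ((-a₀ ^ 2 + a₁ ^ 2 + a₂ ^ 2) / (a₁ ^ 2 + a₂ ^ 2)) ≤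
        (a₀ * ξ + b₀ * κ +
            Real.sqrt ((a₁ * ξ + b₁ * κ) ^ 2 + (a₂ * ξ + b₂ * κ) ^ 2 + c ^ 2))
        - (a₀ * ξ' + b₀ * κ -
            Real.sqrt ((a₁ * ξ' + b₁ * κ) ^ 2 + (a₂ * ξ' + b₂ * κ) ^ 2 + c ^ 2)) := by
  intro ξ ξ' κ
  have hA : 0 < a₁ ^ 2 + a₂ ^ 2 := by nlinarith [sq_nonneg a₀]
  have h₁ := linear_add_le_sqrt (-a₀) a₁ a₂ c (a₁ * ξ + b₁ * κ) (a₂ * ξ + b₂ * κ)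
    (by rwa [neg_sq])
  have h₂ := linear_add_le_sqrt a₀ a₁ a₂ c (a₁ * ξ' + b₁ * κ) (a₂ * ξ' + b₂ * κ) hd
  rw [neg_sq] at h₁
  have hlin : -a₀ * (a₁ * (a₁ * ξ + b₁ * κ) + a₂ * (a₂ * ξ + b₂ * κ)) / (a₁ ^ 2 + a₂ ^ 2) +
      a₀ * (a₁ * (a₁ * ξ' + b₁ * κ) + a₂ * (a₂ * ξ' + b₂ * κ)) / (a₁ ^ 2 + a₂ ^ 2) =
      -a₀ * (ξ - ξ') := by
    field_simp
    ring
  linarith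
end
end

section
/- Let a₀, a₁, a₂, b₀, b₁, b₂, c ∈ ℝ, assume d := −a₀² + a₁² + a₂² > 0, and set s := a₁² + a₂². Then for every κ ∈ ℝ: the set {Ω₊(ξ, κ) : ξ ∈ ℝ} has least element η₊(κ) = (b₀ − a₀(a₁b₁ + a₂b₂)/s)·κ + Real.sqrt (d·((a₁b₂ − a₂b₁)²·κ² + s·c²)) / s, and the set {Ω₋(ξ, κ) : ξ ∈ ℝ} has greatest element η₋(κ) = (b₀ − a₀(a₁b₁ + a₂b₂)/s)·κ − Real.sqrt (d·((a₁b₂ − a₂b₁)²·κ² + s·c²)) / s. (These explicit band-edge formulas are established in the proof of Proposition 6.8 in Appendix E.) -/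
noncomputable section

/-- The least value of a linear function plus the square root of a dominating quadratic. -/
theorem isLeast_range_linear_add_sqrt
    (a₀ a₁ a₂ b₀ b₁ b₂ c κ : ℝ) (hd : 0 < -a₀ ^ 2 + a₁ ^ 2 + a₂ ^ 2) :
    IsLeast (Set.range fun ξ : ℝ =>
        a₀ * ξ + b₀ * κ +
          Real.sqrt ((a₁ * ξ + b₁ * κ) ^ 2 + (a₂ * ξ + b₂ * κ) ^ 2 + c ^ 2))
      ((b₀ - a₀ * (a₁ * b₁ + a₂ * b₂) / (a₁ ^ 2 + a₂ ^ 2)) * κ +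
        Real.sqrt ((-a₀ ^ 2 + a₁ ^ 2 + a₂ ^ 2) *
          ((a₁ * b₂ - a₂ * b₁) ^ 2 * κ ^ 2 + (a₁ ^ 2 + a₂ ^ 2) * c ^ 2))
          / (a₁ ^ 2 + a₂ ^ 2)) := by
  have hs : 0 < a₁ ^ 2 + a₂ ^ 2 := by nlinarith [sq_nonneg a₀]
  obtain ⟨s, hsdef⟩ : ∃ s, s = a₁ ^ 2 + a₂ ^ 2 := ⟨_, rfl⟩
  obtain ⟨d, hddef⟩ : ∃ d, d = -a₀ ^ 2 + a₁ ^ 2 + a₂ ^ 2 := ⟨_, rfl⟩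
  obtain ⟨p, hp⟩ : ∃ p, p = a₁ * b₁ + a₂ * b₂ := ⟨_, rfl⟩
  obtain ⟨E, hE⟩ : ∃ E, E = (a₁ * b₂ - a₂ * b₁) ^ 2 * κ ^ 2 + s * c ^ 2 := ⟨_, rfl⟩
  have hsd : s = d + a₀ ^ 2 := by rw [hsdef, hddef]; ring
  have hQ (ξ : ℝ) : s * ((a₁ * ξ + b₁ * κ) ^ 2 + (a₂ * ξ + b₂ * κ) ^ 2 + c ^ 2) =
      (s * ξ + p * κ) ^ 2 + E := by
    rw [hE, hp, hsdef]; ring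
  rw [← hddef, ← hsdef, ← hE, ← hp]
  rw [← hsdef] at hs
  rw [← hddef] at hd
  have hE0 : 0 ≤ E := by rw [hE]; positivity
  have hR0 := Real.sqrt_nonneg (d * E)
  have hR2 := Real.sq_sqrt (mul_nonneg hd.le hE0)
  generalize Real.sqrt (d * E) = R at hR0 hR2 ⊢
  clear hsdef hddef hp hE
  constructor
  · refine ⟨(-a₀ * R / d - p * κ) / s, ?_⟩
    have hroot : Real.sqrt ((a₁ * ((-a₀ * R / d - p * κ) / s) + b₁ * κ) ^ 2 +
        (a₂ * ((-a₀ * R / d - p * κ) / s) + b₂ * κ) ^ 2 + c ^ 2) = R / d := by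
      rw [Real.sqrt_eq_iff_mul_self_eq (by positivity) (by positivity)]
      apply mul_left_cancel₀ hs.ne'
      rw [hQ, mul_div_cancel₀ _ hs.ne', sub_add_cancel]
      have hEd : E = R ^ 2 / d := by rw [hR2]; field_simp
      rw [hEd, hsd]
      field_simp
      ring
    simp only [hroot]
    field_simp
    rw [hsd]
    ring
  · rintro _ ⟨ξ, rfl⟩
    specialize hQ ξ
    have hQ0 : 0 ≤ (a₁ * ξ + b₁ * κ) ^ 2 + (a₂ * ξ + b₂ * κ) ^ 2 + c ^ 2 := by positivity
    have hr0 := Real.sqrt_nonneg ((a₁ * ξ + b₁ * κ) ^ 2 + (a₂ * ξ + b₂ * κ) ^ 2 + c ^ 2)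
    have hr2 := Real.sq_sqrt hQ0
    simp only
    rw [← hr2] at hQ
    generalize Real.sqrt ((a₁ * ξ + b₁ * κ) ^ 2 + (a₂ * ξ + b₂ * κ) ^ 2 + c ^ 2) = r at *
    have hsq : (R - a₀ * (s * ξ + p * κ)) ^ 2 ≤ (s * r) ^ 2 := by
      have hid : d * ((s * r) ^ 2 - (R - a₀ * (s * ξ + p * κ)) ^ 2) =
          (d * (s * ξ + p * κ) + a₀ * R) ^ 2 := by
        linear_combination d * s * hQ + (- d - a₀ ^ 2) * hR2 +
          d * ((s * ξ + p * κ) ^ 2 + E) * hsd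
      have hnonneg := (mul_nonneg_iff_of_pos_left hd).mp (hid ▸ sq_nonneg _)
      linarith
    have hle := abs_le_of_sq_le_sq' hsq (by positivity)
    have hdiff : a₀ * ξ + b₀ * κ + r - ((b₀ - a₀ * p / s) * κ + R / s) =
        (s * r - (R - a₀ * (s * ξ + p * κ))) / s := by
      field_simp
      ring
    have hpos := div_nonneg (sub_nonneg.mpr hle.2) hs.le
    linarith

/-- explicit band-edge formulas from the proof of Proposition 6.8:
for each κ, the upper symbol band of 𝔇⁺(κ) attains the least value η₊(κ) and the
lower symbol band attains the greatest value η₋(κ). -/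
theorem dirac_symbol_band_edges
    (a₀ a₁ a₂ b₀ b₁ b₂ c : ℝ) (hd : 0 < -a₀ ^ 2 + a₁ ^ 2 + a₂ ^ 2) :
    ∀ κ : ℝ,
      IsLeast (Set.range fun ξ : ℝ =>
          a₀ * ξ + b₀ * κ +
            Real.sqrt ((a₁ * ξ + b₁ * κ) ^ 2 + (a₂ * ξ + b₂ * κ) ^ 2 + c ^ 2))
        ((b₀ - a₀ * (a₁ * b₁ + a₂ * b₂) / (a₁ ^ 2 + a₂ ^ 2)) * κ +
          Real.sqrt ((-a₀ ^ 2 + a₁ ^ 2 + a₂ ^ 2) *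
            ((a₁ * b₂ - a₂ * b₁) ^ 2 * κ ^ 2 + (a₁ ^ 2 + a₂ ^ 2) * c ^ 2))
            / (a₁ ^ 2 + a₂ ^ 2)) ∧
      IsGreatest (Set.range fun ξ : ℝ =>
          a₀ * ξ + b₀ * κ -
            Real.sqrt ((a₁ * ξ + b₁ * κ) ^ 2 + (a₂ * ξ + b₂ * κ) ^ 2 + c ^ 2))
        ((b₀ - a₀ * (a₁ * b₁ + a₂ * b₂) / (a₁ ^ 2 + a₂ ^ 2)) * κ -
          Real.sqrt ((-a₀ ^ 2 + a₁ ^ 2 + a₂ ^ 2) *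
            ((a₁ * b₂ - a₂ * b₁) ^ 2 * κ ^ 2 + (a₁ ^ 2 + a₂ ^ 2) * c ^ 2))
            / (a₁ ^ 2 + a₂ ^ 2)) := by
  intro κ
  refine ⟨isLeast_range_linear_add_sqrt a₀ a₁ a₂ b₀ b₁ b₂ c κ hd, ?_⟩
  have h := isLeast_range_linear_add_sqrt (-a₀) a₁ a₂ (-b₀) b₁ b₂ c κ (by rwa [neg_sq])
  rw [neg_sq] at h
  obtain ⟨⟨ξ, hξ⟩, hlow⟩ := h
  refine ⟨⟨ξ, ?_⟩, ?_⟩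
  · simp only at hξ ⊢
    linear_combination -hξ
  · rintro _ ⟨ζ, rfl⟩
    have hζ := hlow ⟨ζ, rfl⟩
    simp only at hζ ⊢
    rw [neg_mul a₀ (a₁ * b₁ + a₂ * b₂), neg_div] at hζ
    linarith
end
end

section
/- Let a₀, a₁, a₂, b₀, b₁, b₂, c ∈ ℝ with a₀² > a₁² + a₂². Then for every κ ∈ ℝ, both functions ξ ↦ Ω₊(ξ, κ) and ξ ↦ Ω₋(ξ, κ) are surjective from ℝ onto ℝ. (This proves the necessity direction of Proposition 6.8: when −a₀² + a₁² + a₂² < 0 the two symbol bands each cover all of ℝ, so the essential spectrum of 𝔇⁺(κ) has no gap.) -/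
noncomputable section

open Filter in
/-- A perturbation of at most linear growth, with rate below the slope of an affine function,
does not destroy its surjectivity (positive slope). -/
theorem surjective_affine_add_of_pos {a s : ℝ} (d M : ℝ) {g : ℝ → ℝ} (hg : Continuous g)
    (hs : s < a) (hM : ∀ x, |g x| ≤ s * |x| + M) :
    Function.Surjective (fun x => a * x + d + g x) := by
  have hpos : 0 < a - s := sub_pos.mpr hs
  refine Continuous.surjective (by fun_prop) ?_ ?_
  · refine tendsto_atTop_mono' atTop ?_
      (tendsto_atTop_add_const_right atTop (d - M) (tendsto_id.const_mul_atTop hpos))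
    filter_upwards [eventually_ge_atTop 0] with x hx
    have h := (abs_le.mp (hM x)).1
    rw [abs_of_nonneg hx] at h
    simp only [id]
    linarith
  · refine tendsto_atBot_mono' atBot ?_
      (tendsto_atBot_add_const_right atBot (d + M) (tendsto_id.const_mul_atBot hpos))
    filter_upwards [eventually_le_atBot 0] with x hx
    have h := (abs_le.mp (hM x)).2
    rw [abs_of_nonpos hx] at h
    simp only [id]
    linarith

/-- A perturbation of at most linear growth, with rate below the absolute slope of an affine
function, does not destroy its surjectivity. -/
theorem surjective_affine_add {a s : ℝ} (d M : ℝ) {g : ℝ → ℝ} (hg : Continuous g)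
    (hs : s < |a|) (hM : ∀ x, |g x| ≤ s * |x| + M) :
    Function.Surjective (fun x => a * x + d + g x) := by
  rcases le_total 0 a with ha | ha
  · rw [abs_of_nonneg ha] at hs
    exact surjective_affine_add_of_pos d M hg hs hM
  · rw [abs_of_nonpos ha] at hs
    intro y
    obtain ⟨x, hx⟩ := surjective_affine_add_of_pos d M (g := fun x => g (-x)) (by fun_prop) hs
      (fun x => by simpa using hM (-x)) y
    refine ⟨-x, ?_⟩
    simp only at hx ⊢
    linarith

theorem sqrt_sq_add_sq_add_sq_le (a₁ a₂ p q c x : ℝ) :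
    √((a₁ * x + p) ^ 2 + (a₂ * x + q) ^ 2 + c ^ 2) ≤
      √(a₁ ^ 2 + a₂ ^ 2) * |x| + √(p ^ 2 + q ^ 2 + c ^ 2) := by
  have hS : √(a₁ ^ 2 + a₂ ^ 2) ^ 2 = a₁ ^ 2 + a₂ ^ 2 := Real.sq_sqrt (by positivity)
  have hM : √(p ^ 2 + q ^ 2 + c ^ 2) ^ 2 = p ^ 2 + q ^ 2 + c ^ 2 := Real.sq_sqrt (by positivity)
  refine Real.sqrt_le_iff.mpr ⟨by positivity, ?_⟩
  have hcross : x * (a₁ * p + a₂ * q) ≤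
      √(a₁ ^ 2 + a₂ ^ 2) * |x| * √(p ^ 2 + q ^ 2 + c ^ 2) := by
    refine (abs_le_of_sq_le_sq' ?_ (by positivity)).2
    rw [mul_pow, mul_pow, mul_pow, hS, hM, sq_abs]
    have : (a₁ * p + a₂ * q) ^ 2 ≤ (a₁ ^ 2 + a₂ ^ 2) * (p ^ 2 + q ^ 2 + c ^ 2) := by
      nlinarith [sq_nonneg (a₁ * q - a₂ * p), sq_nonneg (a₁ * c), sq_nonneg (a₂ * c)]
    nlinarith [mul_le_mul_of_nonneg_left this (sq_nonneg x)]
  rw [add_sq (√(a₁ ^ 2 + a₂ ^ 2) * |x|), mul_pow _ |x|, hS, hM, sq_abs]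
  linarith

/-- necessity direction of Proposition 6.8: when `a₀² > a₁² + a₂²`,
each of the two symbol bands of 𝔇⁺(κ) covers all of ℝ, so there is no gap. -/
theorem dirac_symbol_bands_surjective_of_no_gap
    (a₀ a₁ a₂ b₀ b₁ b₂ c : ℝ) (h : a₀ ^ 2 > a₁ ^ 2 + a₂ ^ 2) :
    ∀ κ : ℝ,
      Function.Surjective (fun ξ : ℝ =>
        a₀ * ξ + b₀ * κ +
          Real.sqrt ((a₁ * ξ + b₁ * κ) ^ 2 + (a₂ * ξ + b₂ * κ) ^ 2 + c ^ 2)) ∧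
      Function.Surjective (fun ξ : ℝ =>
        a₀ * ξ + b₀ * κ -
          Real.sqrt ((a₁ * ξ + b₁ * κ) ^ 2 + (a₂ * ξ + b₂ * κ) ^ 2 + c ^ 2)) := by
  intro κ
  have hs : √(a₁ ^ 2 + a₂ ^ 2) < |a₀| := by
    rw [← Real.sqrt_sq_eq_abs]
    exact Real.sqrt_lt_sqrt (by positivity) h
  have hbound := sqrt_sq_add_sq_add_sq_le a₁ a₂ (b₁ * κ) (b₂ * κ) c
  constructor
  · refine surjective_affine_add (b₀ * κ) (√((b₁ * κ) ^ 2 + (b₂ * κ) ^ 2 + c ^ 2))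
      (by fun_prop) hs fun x => ?_
    rw [abs_of_nonneg (Real.sqrt_nonneg _)]
    exact hbound x
  · simp only [sub_eq_add_neg]
    refine surjective_affine_add (b₀ * κ) (√((b₁ * κ) ^ 2 + (b₂ * κ) ^ 2 + c ^ 2))
      (by fun_prop) hs fun x => ?_
    rw [abs_neg, abs_of_nonneg (Real.sqrt_nonneg _)]
    exact hbound x
end
end

section
/- Let a₀, a₁, a₂, b₀, b₁, b₂, c, κ ∈ ℝ, Ω ∈ ℂ, and let χ : ℝ → ℝ be odd (χ(−X) = −χ(X) for all X). Suppose ψ : ℝ → ℂ² is differentiable and satisfies, for every X ∈ ℝ, (a₀σ₀ + a₁σ₁ + a₂σ₂)·(−i·ψ'(X)) + κ·(b₀σ₀ + b₁σ₁ + b₂σ₂)·ψ(X) + c·χ(X)·σ₃·ψ(X) = Ω·ψ(X). Then φ(X) := ψ(−X) is differentiable and satisfies, for every X ∈ ℝ, (a₀σ₀ + a₁σ₁ + a₂σ₂)·(−i·φ'(X)) + (−κ)·(b₀σ₀ + b₁σ₁ + b₂σ₂)·φ(X) + c·χ(X)·σ₃·φ(X) = −Ω·φ(X). (Supplementary Proposition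 S2: for odd domain walls, if (Ω, ψ) is an eigenpair of 𝔇⁺(κ) then (−Ω, 𝒫ψ) is an eigenpair of 𝔇⁺(−κ); hence the gap eigenvalue curve satisfies Ω(−κ) = −Ω(κ).) -/
open MeasureTheory Matrix Filter
open scoped ComplexConjugate

noncomputable section

/-- Supplementary Proposition S2: for odd domain walls, if `(Ω, ψ)` is
an eigenpair of 𝔇⁺(κ) then `(−Ω, 𝒫ψ)` is an eigenpair of 𝔇⁺(−κ). -/
theorem dirac_parity_symmetry_for_odd_domain_walls
    (a₀ a₁ a₂ b₀ b₁ b₂ c κ : ℝ) (Ω : ℂ)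
    (χ : ℝ → ℝ) (hodd : ∀ X : ℝ, χ (-X) = -χ X)
    (ψ : ℝ → EuclideanSpace ℂ (Fin 2)) (hψ : Differentiable ℝ ψ)
    (heq : ∀ X : ℝ,
      act ((a₀ : ℂ) • σ₀ + (a₁ : ℂ) • σ₁ + (a₂ : ℂ) • σ₂) ((-Complex.I) • deriv ψ X)
        + κ • act ((b₀ : ℂ) • σ₀ + (b₁ : ℂ) • σ₁ + (b₂ : ℂ) • σ₂) (ψ X)
        + (c * χ X) • act σ₃ (ψ X) = Ω • ψ X) :
    Differentiable ℝ (fun Y : ℝ => ψ (-Y)) ∧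
    ∀ X : ℝ,
      act ((a₀ : ℂ) • σ₀ + (a₁ : ℂ) • σ₁ + (a₂ : ℂ) • σ₂)
          ((-Complex.I) • deriv (fun Y : ℝ => ψ (-Y)) X)
        + (-κ) • act ((b₀ : ℂ) • σ₀ + (b₁ : ℂ) • σ₁ + (b₂ : ℂ) • σ₂) (ψ (-X))
        + (c * χ X) • act σ₃ (ψ (-X)) = (-Ω) • ψ (-X) := by
  refine ⟨hψ.comp differentiable_neg, fun X => ?_⟩
  have h := congrArg Neg.neg (heq (-X))
  rw [hodd] at h
  rw [deriv_comp_neg, neg_smul Ω, ← h]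
  simp only [act, smul_neg, map_neg, mul_neg, neg_smul]
  abel
end
end

section
/- Let H be a complex inner product space with inner product ⟪·,·⟫ (conjugate-linear in the first argument). Let J : H → H be additive and conjugate-linear (J(c•x) = conj(c)•J(x) for all c ∈ ℂ, x ∈ H), with J(J(x)) = x and ⟪J x, J y⟫ = ⟪y, x⟫ for all x, y ∈ H (an antiunitary involution). Let W : H →ₗ[ℂ] H be a linear map which is symmetric, ⟪W x, y⟫ = ⟪x, W y⟫ for all x, y ∈ H, and anticommutes with J: W(J x) = −J(W x) for all x ∈ H. Let Φ₁ ∈ H and Φ₂ := J Φ₁. Then ⟪Φ₁, W Φ₂⟫ = 0 and ⟪Φ₂, W Φ₂⟫ = −⟪Φ₁, W Φ₁⟫. (Propositions A.3 and A.4: for a self-adjoint perturbation W anticommuting with the 𝒫𝒞 symmetry, the matrix of W in the basis {Φ₁, Φ₂ = 𝒫𝒞Φ₁} of the degenerate eigenspace is θ·σ₃ with θ = ⟨Φ₁, WΦ₁⟩; this is what opens the spectral gap.) -/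
open scoped InnerProductSpace ComplexConjugate

/-- Propositions A.3/A.4: for a symmetric linear map `W` anticommuting
with an antiunitary involution `J`, and `Φ₂ = JΦ₁`, the matrix of `W` in the basis
`{Φ₁, Φ₂}` is off-diagonal-free: `⟪Φ₁, WΦ₂⟫ = 0` and `⟪Φ₂, WΦ₂⟫ = −⟪Φ₁, WΦ₁⟫`. -/
theorem symmetry_breaking_matrix_elements
    {H : Type*} [NormedAddCommGroup H] [InnerProductSpace ℂ H]
    (J : H → H)
    (Jadd : ∀ x y : H, J (x + y) = J x + J y)
    (Jsmul : ∀ (c : ℂ) (x : H), J (c • x) = (conj c) • J x)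
    (Jinv : ∀ x : H, J (J x) = x)
    (Jinner : ∀ x y : H, (⟪J x, J y⟫_ℂ) = ⟪y, x⟫_ℂ)
    (W : H →ₗ[ℂ] H)
    (Wsym : ∀ x y : H, (⟪W x, y⟫_ℂ) = ⟪x, W y⟫_ℂ)
    (Wanti : ∀ x : H, W (J x) = -J (W x))
    (Φ₁ : H) :
    (⟪Φ₁, W (J Φ₁)⟫_ℂ) = 0 ∧ (⟪J Φ₁, W (J Φ₁)⟫_ℂ) = -⟪Φ₁, W Φ₁⟫_ℂ := by
  constructor
  · have h : ⟪Φ₁, W (J Φ₁)⟫_ℂ = -⟪Φ₁, W (J Φ₁)⟫_ℂ := by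
      calc ⟪Φ₁, W (J Φ₁)⟫_ℂ = -⟪J (J Φ₁), J (W Φ₁)⟫_ℂ := by rw [Wanti, inner_neg_right, Jinv]
        _ = -⟪Φ₁, W (J Φ₁)⟫_ℂ := by rw [Jinner, Wsym]
    exact self_eq_neg.mp h
  · rw [Wanti, inner_neg_right, Jinner, Wsym]
end
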